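/- Let M = U D U^{-1} be an n × n diagonalizable matrix with diagonal D, and let M̂ = M(I + E) + F. Suppose κ(U)(‖ME‖₂ + ‖F‖₂) < sep(D)/2 (so that the eigenvalues of M̂ are distinct and M̂ is diagonalizable, with each unit eigenvector û_i of M̂ paired with the corresponding unit eigenvector u_i of M). Then for each i, ‖û_i − u_i‖₂ ≤ 3(σ_max(E) λ_max(D) + σ_max(F)) / (σ_min(U) · sep(D)). -/

import Mathlib

noncomputable section

/-- Euclidean norm of a vector indexed by a finite type. -/
def enorm2 {ι : Type*} [Fintype ι] (x : ι → ℝ) : ℝ :=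
  Real.sqrt (∑ i, x i ^ 2)

/-- The `k`-th largest singular value of a real matrix, via the Courant–Fischer
characterization. -/
def singVal {ι κ : Type*} [Fintype ι] [Fintype κ] (A : Matrix ι κ ℝ) (k : ℕ) : ℝ :=
  sSup {s : ℝ | ∃ V : Submodule ℝ (κ → ℝ), Module.finrank ℝ V = k ∧
    s = sInf {t : ℝ | ∃ x ∈ V, enorm2 x = 1 ∧ t = enorm2 (A.mulVec x)}}

/-- Minimum separation between the diagonal entries of a diagonal matrix. -/
def sepD {n : ℕ} (D : Fin n → ℝ) : ℝ :=
  sInf {t : ℝ | ∃ i j : Fin n, i ≠ j ∧ t = |D i - D j|}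

theorem enorm2_eq_norm {ι : Type*} [Fintype ι] (x : ι → ℝ) :
    enorm2 x = ‖WithLp.toLp 2 x‖ := by
  simp [enorm2, EuclideanSpace.norm_eq]

theorem enorm2_nonneg {ι : Type*} [Fintype ι] (x : ι → ℝ) : 0 ≤ enorm2 x :=
  Real.sqrt_nonneg _

theorem enorm2_sq {ι : Type*} [Fintype ι] (x : ι → ℝ) : enorm2 x ^ 2 = ∑ i, x i ^ 2 :=
  Real.sq_sqrt (Finset.sum_nonneg fun _ _ => sq_nonneg _)

theorem enorm2_add_le {ι : Type*} [Fintype ι] (x y : ι → ℝ) :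
    enorm2 (x + y) ≤ enorm2 x + enorm2 y := by
  simp only [enorm2_eq_norm, WithLp.toLp_add]
  exact norm_add_le _ _

theorem enorm2_smul {ι : Type*} [Fintype ι] (a : ℝ) (x : ι → ℝ) :
    enorm2 (a • x) = |a| * enorm2 x := by
  simp only [enorm2_eq_norm, WithLp.toLp_smul, norm_smul, Real.norm_eq_abs]

theorem enorm2_pos {ι : Type*} [Fintype ι] {x : ι → ℝ} (hx : x ≠ 0) : 0 < enorm2 x := by
  rw [enorm2_eq_norm, norm_pos_iff]
  simpa using hx

theorem enorm2_zero {ι : Type*} [Fintype ι] : enorm2 (0 : ι → ℝ) = 0 := by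
  simp [enorm2]

theorem enorm2_normalize {ι : Type*} [Fintype ι] {x : ι → ℝ} (hx : x ≠ 0) :
    enorm2 ((enorm2 x)⁻¹ • x) = 1 := by
  rw [enorm2_smul, abs_of_pos (inv_pos.2 (enorm2_pos hx)), inv_mul_cancel₀ (enorm2_pos hx).ne']

theorem enorm2_sub_smul_sq {ι : Type*} [Fintype ι] (x y : ι → ℝ) (a : ℝ) :
    enorm2 (x - a • y) ^ 2 = enorm2 x ^ 2 - 2 * a * (x ⬝ᵥ y) + a ^ 2 * enorm2 y ^ 2 := by
  simp only [enorm2_sq, dotProduct, Finset.mul_sum, ← Finset.sum_sub_distrib,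
    ← Finset.sum_add_distrib]
  refine Finset.sum_congr rfl fun i _ => ?_
  simp only [Pi.sub_apply, Pi.smul_apply, smul_eq_mul]
  ring

theorem exists_enorm2_mulVec_le {ι κ : Type*} [Fintype ι] [Fintype κ] (A : Matrix ι κ ℝ) :
    ∃ B : ℝ, ∀ x, enorm2 (A.mulVec x) ≤ B * enorm2 x := by
  classical
  refine ⟨‖(Matrix.toEuclideanLin A).toContinuousLinearMap‖, fun x => ?_⟩
  rw [enorm2_eq_norm, enorm2_eq_norm]
  exact (Matrix.toEuclideanLin A).toContinuousLinearMap.le_opNorm (WithLp.toLp 2 x)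

theorem bddBelow_enorm2_mulVec {ι κ : Type*} [Fintype ι] [Fintype κ] (A : Matrix ι κ ℝ)
    (V : Submodule ℝ (κ → ℝ)) :
    BddBelow {t : ℝ | ∃ x ∈ V, enorm2 x = 1 ∧ t = enorm2 (A.mulVec x)} := by
  refine ⟨0, ?_⟩
  rintro _ ⟨x, _, _, rfl⟩
  exact enorm2_nonneg _

theorem singVal_nonneg {ι κ : Type*} [Fintype ι] [Fintype κ] (A : Matrix ι κ ℝ) (k : ℕ) :
    0 ≤ singVal A k := by
  refine Real.sSup_nonneg ?_
  rintro _ ⟨V, _, rfl⟩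
  refine Real.sInf_nonneg ?_
  rintro _ ⟨x, _, _, rfl⟩
  exact enorm2_nonneg _

theorem enorm2_mulVec_le_singVal_one {ι κ : Type*} [Fintype ι] [Fintype κ] (A : Matrix ι κ ℝ)
    (x : κ → ℝ) : enorm2 (A.mulVec x) ≤ singVal A 1 * enorm2 x := by
  rcases eq_or_ne x 0 with rfl | hx
  · simp [enorm2_zero]
  have hpos := enorm2_pos hx
  have key : enorm2 (A.mulVec ((enorm2 x)⁻¹ • x)) ≤ singVal A 1 := by
    obtain ⟨B, hB⟩ := exists_enorm2_mulVec_le A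
    have hbdd : BddAbove {s : ℝ | ∃ V : Submodule ℝ (κ → ℝ), Module.finrank ℝ V = 1 ∧
        s = sInf {t : ℝ | ∃ x ∈ V, enorm2 x = 1 ∧ t = enorm2 (A.mulVec x)}} := by
      refine ⟨B, ?_⟩
      rintro _ ⟨V, hV, rfl⟩
      obtain ⟨⟨y, hyV⟩, hy0, -⟩ := finrank_eq_one_iff'.1 hV
      have hy : y ≠ 0 := fun h => hy0 (Subtype.ext h)
      refine (csInf_le (bddBelow_enorm2_mulVec A V)
        ⟨(enorm2 y)⁻¹ • y, V.smul_mem _ hyV, enorm2_normalize hy, rfl⟩).trans ?_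
      simpa [enorm2_normalize hy] using hB ((enorm2 y)⁻¹ • y)
    refine le_trans ?_ (le_csSup hbdd ⟨Submodule.span ℝ {x}, finrank_span_singleton hx, rfl⟩)
    refine le_csInf ⟨_, (enorm2 x)⁻¹ • x,
      Submodule.smul_mem _ _ (Submodule.mem_span_singleton_self x), enorm2_normalize hx, rfl⟩ ?_
    rintro _ ⟨y, hy, hy1, rfl⟩
    obtain ⟨a, rfl⟩ := Submodule.mem_span_singleton.1 hy
    rw [enorm2_smul] at hy1
    rw [Matrix.mulVec_smul, Matrix.mulVec_smul, enorm2_smul, enorm2_smul,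
      abs_of_pos (inv_pos.2 hpos), eq_inv_of_mul_eq_one_left hy1]
  rw [Matrix.mulVec_smul, enorm2_smul, abs_of_pos (inv_pos.2 hpos), inv_mul_le_iff₀ hpos] at key
  linarith

theorem singVal_finrank_eq {ι : Type*} {n : ℕ} [Fintype ι] (A : Matrix ι (Fin n) ℝ) :
    singVal A n = sInf {t : ℝ | ∃ x, enorm2 x = 1 ∧ t = enorm2 (A.mulVec x)} := by
  have : {s : ℝ | ∃ V : Submodule ℝ (Fin n → ℝ), Module.finrank ℝ V = n ∧
      s = sInf {t : ℝ | ∃ x ∈ V, enorm2 x = 1 ∧ t = enorm2 (A.mulVec x)}} =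
      {sInf {t : ℝ | ∃ x, enorm2 x = 1 ∧ t = enorm2 (A.mulVec x)}} := by
    ext s
    simp only [Set.mem_ofPred_eq, Set.mem_singleton_iff]
    constructor
    · rintro ⟨V, hV, rfl⟩
      obtain rfl : V = ⊤ := Submodule.eq_top_of_finrank_eq (by simpa using hV)
      simp
    · rintro rfl
      exact ⟨⊤, by simp, by simp⟩
  rw [singVal, this, csSup_singleton]

theorem singVal_mul_enorm2_le {ι : Type*} {n : ℕ} [Fintype ι] (A : Matrix ι (Fin n) ℝ)
    (x : Fin n → ℝ) : singVal A n * enorm2 x ≤ enorm2 (A.mulVec x) := by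
  rcases eq_or_ne x 0 with rfl | hx
  · simp [enorm2_zero]
  have hpos := enorm2_pos hx
  have key : singVal A n ≤ enorm2 (A.mulVec ((enorm2 x)⁻¹ • x)) := by
    rw [singVal_finrank_eq]
    refine csInf_le ⟨0, ?_⟩ ⟨_, enorm2_normalize hx, rfl⟩
    rintro _ ⟨x, _, rfl⟩
    exact enorm2_nonneg _
  rwa [Matrix.mulVec_smul, enorm2_smul, abs_of_pos (inv_pos.2 hpos), ← div_eq_inv_mul,
    le_div_iff₀ hpos] at key

theorem singVal_pos_of_isUnit_det {n : ℕ} {U : Matrix (Fin n) (Fin n) ℝ} (hU : IsUnit U.det)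
    {x : Fin n → ℝ} (hx : enorm2 x = 1) : 0 < singVal U n := by
  have hle : ∀ y : Fin n → ℝ, enorm2 y ≤ singVal U⁻¹ 1 * enorm2 (U.mulVec y) := fun y => by
    simpa [Matrix.mulVec_mulVec, Matrix.nonsing_inv_mul U hU] using
      enorm2_mulVec_le_singVal_one U⁻¹ (U.mulVec y)
  have hL : 0 < singVal U⁻¹ 1 := by
    have h := hle x
    rw [hx] at h
    exact pos_of_mul_pos_left (by linarith) (enorm2_nonneg _)
  rw [singVal_finrank_eq]
  refine (inv_pos.2 hL).trans_le (le_csInf ⟨_, x, hx, rfl⟩ ?_)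
  rintro _ ⟨y, hy, rfl⟩
  rw [inv_le_iff_one_le_mul₀' hL, ← hy]
  exact hle y

theorem enorm2_mulVec_le_sum_abs {ι κ : Type*} [Fintype ι] [Fintype κ] (U : Matrix ι κ ℝ)
    (hcols : ∀ i, enorm2 (fun p => U p i) = 1) (c : κ → ℝ) :
    enorm2 (U.mulVec c) ≤ ∑ j, |c j| := by
  have h : WithLp.toLp 2 (U.mulVec c) = ∑ j, c j • WithLp.toLp 2 (fun p => U p j) := by
    ext p
    simp [Matrix.mulVec, dotProduct, mul_comm]
  rw [enorm2_eq_norm, h]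
  refine (norm_sum_le _ _).trans (Finset.sum_le_sum fun j _ => ?_)
  rw [norm_smul, ← enorm2_eq_norm, hcols, mul_one, Real.norm_eq_abs]

theorem enorm2_mul_le {ι : Type*} [Fintype ι] (d x : ι → ℝ) :
    enorm2 (fun j => d j * x j) ≤ (⨆ j, |d j|) * enorm2 x := by
  have h0 : 0 ≤ ⨆ j, |d j| := Real.iSup_nonneg fun _ => abs_nonneg _
  refine le_of_sq_le_sq ?_ (mul_nonneg h0 (enorm2_nonneg _))
  rw [mul_pow, enorm2_sq, enorm2_sq, Finset.mul_sum]
  refine Finset.sum_le_sum fun j _ => ?_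
  rw [mul_pow, ← sq_abs (d j)]
  have := le_ciSup (Set.finite_range fun j => |d j|).bddAbove j
  gcongr

theorem sepD_le {n : ℕ} (D : Fin n → ℝ) {i j : Fin n} (hij : i ≠ j) : sepD D ≤ |D i - D j| := by
  refine csInf_le ⟨0, ?_⟩ ⟨i, j, hij, rfl⟩
  rintro _ ⟨_, _, _, rfl⟩
  exact abs_nonneg _

theorem sum_Ico_inv_sq_le (m N : ℕ) (a : ℝ) (ha : 1 / 2 < m + a) :
    ∑ k ∈ Finset.Ico m (m + N), 1 / ((k : ℝ) + a) ^ 2 ≤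
      1 / (m + a - 1 / 2) - 1 / (m + N + a - 1 / 2) := by
  induction N with
  | zero => simp
  | succ N ih =>
    rw [← add_assoc, Finset.sum_Ico_succ_top (by omega)]
    have hN : (0 : ℝ) ≤ N := N.cast_nonneg
    have h : 1 / (((m + N : ℕ) : ℝ) + a) ^ 2 ≤
        1 / (m + N + a - 1 / 2) - 1 / (m + (N + 1 : ℕ) + a - 1 / 2) := by
      push_cast
      have h1 : (0 : ℝ) < m + N + a - 1 / 2 := by linarith
      have h2 : (0 : ℝ) < m + (N + 1) + a - 1 / 2 := by linarith
      have h3 : (0 : ℝ) < m + N + a := by linarith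
      rw [div_sub_div _ _ h1.ne' h2.ne', div_le_div_iff₀ (pow_pos h3 2) (mul_pos h1 h2)]
      nlinarith
    linarith

/-- A sum of inverse squares over points with pairwise gaps at least `1`, all lying at distance
at least `m` above the origin, is controlled by the telescoping integral bound. -/
theorem sum_inv_sq_le_of_gaps {ι : Type*} (T : Finset ι) (x : ι → ℝ) (m : ℕ) (a : ℝ)
    (hm : 1 / 2 < m + a) (hx : ∀ j ∈ T, (m : ℝ) ≤ x j)
    (hgap : ∀ j ∈ T, ∀ k ∈ T, j ≠ k → 1 ≤ |x j - x k|) :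
    ∑ j ∈ T, 1 / (x j + a) ^ 2 ≤ 1 / (m + a - 1 / 2) := by
  classical
  have hx0 : ∀ j ∈ T, 0 ≤ x j := fun j hj => (Nat.cast_nonneg m).trans (hx j hj)
  have hinj : Set.InjOn (fun j => ⌊x j⌋₊) T := by
    intro j hj k hk h
    by_contra hne
    have h1 := hgap j hj k hk hne
    have e : ⌊x j⌋₊ = ⌊x k⌋₊ := h
    have := Nat.floor_le (hx0 j hj)
    have := Nat.floor_le (hx0 k hk)
    have := Nat.lt_floor_add_one (x j)
    have := Nat.lt_floor_add_one (x k)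
    rw [e] at *
    rcases le_abs.1 h1 with h | h <;> linarith
  have hfl : ∀ j ∈ T, m ≤ ⌊x j⌋₊ := fun j hj => Nat.le_floor (hx j hj)
  calc ∑ j ∈ T, 1 / (x j + a) ^ 2
      ≤ ∑ j ∈ T, 1 / ((⌊x j⌋₊ : ℝ) + a) ^ 2 := by
        refine Finset.sum_le_sum fun j hj => ?_
        have h1 : (m : ℝ) ≤ ⌊x j⌋₊ := by exact_mod_cast hfl j hj
        have h2 := Nat.floor_le (hx0 j hj)
        have h3 : 0 < (⌊x j⌋₊ : ℝ) + a := by linarith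
        gcongr
    _ = ∑ k ∈ T.image (fun j => ⌊x j⌋₊), 1 / ((k : ℝ) + a) ^ 2 := by
        rw [Finset.sum_image hinj]
    _ ≤ ∑ k ∈ Finset.Ico m (m + ((T.image (fun j => ⌊x j⌋₊)).sup id + 1)),
          1 / ((k : ℝ) + a) ^ 2 := by
        refine Finset.sum_le_sum_of_subset_of_nonneg ?_ fun _ _ _ => by positivity
        intro k hk
        have h1 : k ≤ (T.image (fun j => ⌊x j⌋₊)).sup id := Finset.le_sup (f := id) hk
        obtain ⟨j, hj, rfl⟩ := Finset.mem_image.1 hk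
        have := hfl j hj
        rw [Finset.mem_Ico]
        omega
    _ ≤ _ := by
        refine (sum_Ico_inv_sq_le m _ a hm).trans (sub_le_self _ ?_)
        refine one_div_nonneg.2 ?_
        have := Nat.cast_nonneg (α := ℝ) ((T.image (fun j => ⌊x j⌋₊)).sup id + 1)
        linarith

theorem exists_near_set_of_nonneg {ι : Type*} [Fintype ι] [DecidableEq ι] (x : ι → ℝ) (y : ℝ)
    (i : ι) (hgap : ∀ j k, j ≠ k → 1 ≤ |x j - x k|) (hy0 : 0 ≤ y - x i) (hy : y - x i < 1 / 2) :
    ∃ S : Finset ι, S.card ≤ 1 ∧ i ∉ S ∧ (∀ j ∈ S, 1 / 2 ≤ |y - x j|) ∧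
      (∀ j ∉ S, j ≠ i → 1 ≤ |y - x j|) ∧
      ∑ j ∈ (Finset.univ.erase i) \ S, 1 / (y - x j) ^ 2 ≤ 12 / 5 := by
  have hcase : ∀ j, j ≠ i → x j ≤ x i - 1 ∨ x i + 1 ≤ x j := by
    intro j hj
    rcases le_abs.1 (hgap j i hj) with h | h
    · right; linarith
    · left; linarith
  set t := y - x i with ht
  refine ⟨Finset.univ.filter fun j => x i < x j ∧ x j < x i + 2, ?_, by simp, ?_, ?_, ?_⟩
  · refine Finset.card_le_one.2 fun j hj k hk => ?_
    simp only [Finset.mem_filter, Finset.mem_univ, true_and] at hj hk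
    by_contra hne
    have hji : j ≠ i := by rintro rfl; exact lt_irrefl _ hj.1
    have hki : k ≠ i := by rintro rfl; exact lt_irrefl _ hk.1
    rcases hcase j hji with h | h <;> rcases hcase k hki with h' | h' <;>
      rcases le_abs.1 (hgap j k hne) with h'' | h'' <;> linarith [hj.1, hj.2, hk.1, hk.2]
  · intro j hj
    simp only [Finset.mem_filter, Finset.mem_univ, true_and] at hj
    have hji : j ≠ i := by rintro rfl; exact lt_irrefl _ hj.1
    rcases hcase j hji with h | h
    · linarith [hj.1]
    · exact le_abs.2 (Or.inr (by linarith))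
  · intro j hj hji
    simp only [Finset.mem_filter, Finset.mem_univ, true_and, not_and, not_lt] at hj
    rcases hcase j hji with h | h
    · exact le_abs.2 (Or.inl (by linarith))
    · have := hj (by linarith)
      exact le_abs.2 (Or.inr (by linarith))
  · set T := (Finset.univ.erase i) \ Finset.univ.filter fun j => x i < x j ∧ x j < x i + 2 with hT
    have hmem : ∀ j ∈ T, x j ≤ x i - 1 ∨ x i + 2 ≤ x j := by
      intro j hj
      simp only [hT, Finset.mem_sdiff, Finset.mem_erase, Finset.mem_filter, Finset.mem_univ,
        true_and, and_true, not_and, not_lt] at hj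
      rcases hcase j hj.1 with h | h
      · exact Or.inl h
      · exact Or.inr (hj.2 (by linarith))
    rw [← Finset.sum_filter_add_sum_filter_not T (fun j => x j ≤ x i - 1)]
    rw [← Finset.sum_filter_add_sum_filter_not (T.filter fun j => x j ≤ x i - 1)
      (fun j => x i - 2 < x j)]
    have habove : ∑ j ∈ T with ¬ x j ≤ x i - 1, 1 / (y - x j) ^ 2 ≤ 1 / (2 + -t - 1 / 2) := by
      have := sum_inv_sq_le_of_gaps (T.filter fun j => ¬ x j ≤ x i - 1) (fun j => x j - x i) 2 (-t)
        (by push_cast; linarith) ?_ ?_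
      · push_cast at this
        refine le_trans (le_of_eq (Finset.sum_congr rfl fun j _ => ?_)) this
        congr 1
        rw [ht]
        ring
      · intro j hj
        rw [Finset.mem_filter] at hj
        have := (hmem j hj.1).resolve_left hj.2
        push_cast
        linarith
      · intro j _ k _ hjk
        rw [sub_sub_sub_cancel_right]
        exact hgap j k hjk
    have hbelow : ∑ j ∈ T.filter (fun j => x j ≤ x i - 1) with ¬ x i - 2 < x j,
        1 / (y - x j) ^ 2 ≤ 1 / (2 + t - 1 / 2) := by
      have := sum_inv_sq_le_of_gaps ((T.filter fun j => x j ≤ x i - 1).filter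
        fun j => ¬ x i - 2 < x j) (fun j => x i - x j) 2 t (by push_cast; linarith) ?_ ?_
      · push_cast at this
        refine le_trans (le_of_eq (Finset.sum_congr rfl fun j _ => ?_)) this
        congr 1
        rw [ht]
        ring
      · intro j hj
        rw [Finset.mem_filter] at hj
        push_cast
        linarith [not_lt.1 hj.2]
      · intro j _ k _ hjk
        rw [sub_sub_sub_cancel_left]
        exact hgap k j hjk.symm
    have hmid : ∑ j ∈ T.filter (fun j => x j ≤ x i - 1) with x i - 2 < x j,
        1 / (y - x j) ^ 2 ≤ 1 / (1 + t) ^ 2 := by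
      have hcard : ((T.filter fun j => x j ≤ x i - 1).filter fun j => x i - 2 < x j).card ≤ 1 := by
        refine Finset.card_le_one.2 fun j hj k hk => ?_
        simp only [Finset.mem_filter] at hj hk
        by_contra hne
        rcases le_abs.1 (hgap j k hne) with h | h <;>
          linarith [hj.1.2, hj.2, hk.1.2, hk.2]
      refine (Finset.sum_le_card_nsmul _ _ (1 / (1 + t) ^ 2) fun j hj => ?_).trans ?_
      · simp only [Finset.mem_filter] at hj
        have : 1 + t ≤ y - x j := by linarith [hj.1.2]
        gcongr
      · rw [nsmul_eq_mul]
        refine mul_le_of_le_one_left (by positivity) (by exact_mod_cast hcard)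
    have hfin : 1 / (1 + t) ^ 2 + 1 / (2 + t - 1 / 2) + 1 / (2 + -t - 1 / 2) ≤ 12 / 5 := by
      have h1 : 1 / (1 + t) ^ 2 ≤ 1 - t := by
        rw [div_le_iff₀ (by positivity)]
        nlinarith [mul_nonneg hy0 (mul_nonneg hy0 hy0), mul_nonneg hy0 (sub_nonneg.2 hy.le),
          mul_nonneg (mul_nonneg hy0 hy0) (sub_nonneg.2 hy.le)]
      have h2 : 1 / (2 + t - 1 / 2) + 1 / (2 + -t - 1 / 2) ≤ 4 / 3 + t := by
        have h3 : 0 < 2 + t - 1 / 2 := by linarith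
        have h4 : 0 < 2 + -t - 1 / 2 := by linarith
        rw [div_add_div _ _ h3.ne' h4.ne', div_le_iff₀ (mul_pos h3 h4)]
        nlinarith [mul_nonneg hy0 (mul_nonneg hy0 hy0), mul_nonneg hy0 (sub_nonneg.2 hy.le),
          mul_nonneg (mul_nonneg hy0 hy0) (sub_nonneg.2 hy.le)]
      linarith
    linarith

/-- If the points `x j` have pairwise gaps at least `1` and `y` is within `1 / 2` of `x i`, then at
most one further point is within distance `1` of `y`, and the inverse squared distances from `y` to
the remaining points sum to at most `12 / 5`. -/
theorem exists_near_set {ι : Type*} [Fintype ι] [DecidableEq ι] (x : ι → ℝ) (y : ℝ)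
    (i : ι) (hgap : ∀ j k, j ≠ k → 1 ≤ |x j - x k|) (hy : |y - x i| < 1 / 2) :
    ∃ S : Finset ι, S.card ≤ 1 ∧ i ∉ S ∧ (∀ j ∈ S, 1 / 2 ≤ |y - x j|) ∧
      (∀ j ∉ S, j ≠ i → 1 ≤ |y - x j|) ∧
      ∑ j ∈ (Finset.univ.erase i) \ S, 1 / (y - x j) ^ 2 ≤ 12 / 5 := by
  rcases le_total 0 (y - x i) with h | h
  · exact exists_near_set_of_nonneg x y i hgap h (abs_lt.1 hy).2
  · obtain ⟨S, h1, h2, h3, h4, h5⟩ := exists_near_set_of_nonneg (fun j => -x j) (-y) i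
      (fun j k hjk => by
        rw [neg_sub_neg]
        exact hgap k j hjk.symm) (by linarith) (by linarith [(abs_lt.1 hy).1])
    have e : ∀ j, |-y - -x j| = |y - x j| := fun j => by rw [neg_sub_neg, abs_sub_comm]
    have e' : ∀ j, (-y - -x j) ^ 2 = (y - x j) ^ 2 := fun j => by ring
    simp only [e, e'] at h3 h4 h5
    exact ⟨S, h1, h2, h3, h4, h5⟩

theorem scalar_sine_bound {C V g p q : ℝ} (hC : 0 ≤ C) (hg : 0 ≤ g) (hp : 0 ≤ p) (hq : 0 ≤ q)
    (hV : 0 ≤ V) (hCV : 1 - C ^ 2 ≤ V ^ 2) (hVpq : V ≤ p + 31 / 20 * q)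
    (hpq : p ^ 2 / 4 + q ^ 2 ≤ g ^ 2) (hgV : 4 * g ^ 2 * V ^ 2 ≤ p ^ 2 + q ^ 2) :
    2 * (1 - C) ≤ 9 * g ^ 2 := by
  rcases hg.eq_or_lt with rfl | hg
  · have hp0 : p = 0 := by nlinarith [sq_nonneg p, sq_nonneg q]
    have hq0 : q = 0 := by nlinarith [sq_nonneg p, sq_nonneg q]
    have hV0 : V = 0 := by subst hp0 hq0; linarith
    subst hV0
    nlinarith
  obtain ⟨r, rfl⟩ : ∃ r, q = g * r := ⟨q / g, by field_simp⟩
  obtain ⟨w, rfl⟩ : ∃ w, p = g * w := ⟨p / g, by field_simp⟩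
  have hr : 0 ≤ r := nonneg_of_mul_nonneg_right hq hg
  have hw : 0 ≤ w := nonneg_of_mul_nonneg_right hp hg
  have hg2 : 0 < g ^ 2 := by positivity
  have hwr : w ^ 2 / 4 + r ^ 2 ≤ 1 := by
    refine le_of_mul_le_mul_left ?_ hg2
    nlinarith
  have hV2 : 4 * V ^ 2 ≤ w ^ 2 + r ^ 2 := by
    refine le_of_mul_le_mul_left ?_ hg2
    nlinarith
  have hCr : 433 / 500 * r ≤ C := by
    refine le_of_sq_le_sq ?_ hC
    nlinarith
  have hw1 : w ≤ 2 - r ^ 2 := by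
    refine le_of_sq_le_sq ?_ ?_ <;> nlinarith [sq_nonneg (r ^ 2)]
  have hpoly : (w + 31 / 20 * r) ^ 2 ≤ 9 / 2 * (1 + C) := by
    have h1 : (w + 31 / 20 * r) ^ 2 ≤
        4 * (1 - r ^ 2) + 31 / 10 * r * (2 - r ^ 2) + (31 / 20) ^ 2 * r ^ 2 := by
      nlinarith [mul_le_mul_of_nonneg_left hw1 hr]
    have h2 : 4 * (1 - r ^ 2) + 31 / 10 * r * (2 - r ^ 2) + (31 / 20) ^ 2 * r ^ 2 ≤
        9 / 2 * (1 + 433 / 500 * r) := by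
      nlinarith [mul_nonneg hr (sq_nonneg (r - 177 / 500)), sq_nonneg (r - 177 / 500)]
    linarith
  have hVle : V ^ 2 ≤ g ^ 2 * (9 / 2 * (1 + C)) := by
    calc V ^ 2 ≤ (g * w + 31 / 20 * (g * r)) ^ 2 := by gcongr
      _ = g ^ 2 * (w + 31 / 20 * r) ^ 2 := by ring
      _ ≤ _ := by gcongr
  have h : (1 + C) * (2 * (1 - C)) ≤ (1 + C) * (9 * g ^ 2) := by nlinarith
  exact le_of_mul_le_mul_left h (by linarith)

/-- Core estimate: a unit vector `U c` is close to the unit column `u_i` up to sign when the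
residuals `(y - x j) c j` are small, for points `x j` with pairwise gaps at least `1`. -/
theorem exists_sign_enorm2_sub_le {ι κ : Type*} [Fintype ι] [Fintype κ] [DecidableEq κ]
    (U : Matrix ι κ ℝ) (hcols : ∀ i, enorm2 (fun p => U p i) = 1) (x : κ → ℝ) (y : ℝ) (i : κ)
    (hgap : ∀ j k, j ≠ k → 1 ≤ |x j - x k|) (hy : |y - x i| < 1 / 2)
    (c : κ → ℝ) (hc : enorm2 (U.mulVec c) = 1) {L : ℝ}
    (hL : ∀ a, enorm2 (U.mulVec a) ≤ L * enorm2 a)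
    (hLg : 2 * L * enorm2 (fun j => (y - x j) * c j) ≤ 1) :
    ∃ s : ℝ, (s = 1 ∨ s = -1) ∧ enorm2 (U.mulVec c - s • fun p => U p i) ≤
      3 * enorm2 (fun j => (y - x j) * c j) := by
  set g := enorm2 (fun j => (y - x j) * c j) with hg
  have hg0 : 0 ≤ g := enorm2_nonneg _
  set u := U.mulVec c with hu
  set v : ι → ℝ := fun p => U p i with hv
  obtain ⟨S, hcard, hiS, hS, hT, hsum⟩ := exists_near_set x y i hgap hy
  set T := (Finset.univ.erase i) \ S with hTdef
  set c' := Function.update c i 0 with hc'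
  have hsplit : ∀ f : κ → ℝ, ∑ j, f j = f i + (∑ j ∈ S, f j + ∑ j ∈ T, f j) := by
    intro f
    rw [← Finset.add_sum_erase _ _ (Finset.mem_univ i), add_comm (∑ j ∈ S, f j),
      Finset.sum_sdiff]
    intro j hj
    exact Finset.mem_erase.2 ⟨fun h => hiS (h ▸ hj), Finset.mem_univ _⟩
  have hTi : ∀ j ∈ T, j ≠ i ∧ j ∉ S := fun j hj => by
    simpa [hTdef] using hj
  have hSi : ∀ j ∈ S, j ≠ i := fun j hj h => hiS (h ▸ hj)
  have hc'S : ∀ j ∈ S, c' j = c j := fun j hj => by simp [hc', hSi j hj]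
  have hc'T : ∀ j ∈ T, c' j = c j := fun j hj => by simp [hc', (hTi j hj).1]
  have hsplit' : ∀ f : ℝ → ℝ,
      ∑ j, f (c' j) = f 0 + (∑ j ∈ S, f (c j) + ∑ j ∈ T, f (c j)) := by
    intro f
    rw [hsplit, Finset.sum_congr rfl fun j hj => congrArg f (hc'S j hj),
      Finset.sum_congr rfl fun j hj => congrArg f (hc'T j hj), hc', Function.update_self]
  have huv : u - c i • v = U.mulVec c' := by
    have : c' = c - Pi.single i (c i) := by
      ext j
      by_cases h : j = i
      · subst h; simp [hc']
      · simp [hc', h]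
    rw [this, Matrix.mulVec_sub, Matrix.mulVec_single]
    ext p
    simp [hu, hv, mul_comm]
  set V := enorm2 (U.mulVec c') with hV
  set p := Real.sqrt (∑ j ∈ S, c j ^ 2) with hp
  set q := Real.sqrt (∑ j ∈ T, ((y - x j) * c j) ^ 2) with hq
  have hp2 : p ^ 2 = ∑ j ∈ S, c j ^ 2 := Real.sq_sqrt (Finset.sum_nonneg fun _ _ => sq_nonneg _)
  have hq2 : q ^ 2 = ∑ j ∈ T, ((y - x j) * c j) ^ 2 :=
    Real.sq_sqrt (Finset.sum_nonneg fun _ _ => sq_nonneg _)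
  have hd : ∀ j ∈ T, 1 ≤ |y - x j| := fun j hj => hT j (hTi j hj).2 (hTi j hj).1
  have hSsum : ∑ j ∈ S, |c j| ≤ p := by
    refine Real.le_sqrt_of_sq_le ?_
    refine (sq_sum_le_card_mul_sum_sq).trans ?_
    simp only [sq_abs]
    exact mul_le_of_le_one_left (Finset.sum_nonneg fun _ _ => sq_nonneg _) (by exact_mod_cast hcard)
  have hTsum : ∑ j ∈ T, |c j| ≤ 31 / 20 * q := by
    refine le_of_sq_le_sq ?_ (mul_nonneg (by norm_num) (Real.sqrt_nonneg _))
    calc (∑ j ∈ T, |c j|) ^ 2 = (∑ j ∈ T, 1 / |y - x j| * |(y - x j) * c j|) ^ 2 := by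
          congr 1
          refine Finset.sum_congr rfl fun j hj => ?_
          have : |y - x j| ≠ 0 := by linarith [hd j hj]
          rw [abs_mul]
          field_simp
      _ ≤ (∑ j ∈ T, (1 / |y - x j|) ^ 2) * ∑ j ∈ T, |(y - x j) * c j| ^ 2 :=
          Finset.sum_mul_sq_le_sq_mul_sq _ _ _
      _ = (∑ j ∈ T, 1 / (y - x j) ^ 2) * q ^ 2 := by
          simp only [div_pow, one_pow, sq_abs, hq2]
      _ ≤ 12 / 5 * q ^ 2 := by gcongr
      _ ≤ _ := by nlinarith [sq_nonneg q]
  have hVpq : V ≤ p + 31 / 20 * q := by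
    refine (enorm2_mulVec_le_sum_abs U hcols c').trans ?_
    rw [hsplit' fun a => |a|, abs_zero]
    linarith
  have hpq : p ^ 2 / 4 + q ^ 2 ≤ g ^ 2 := by
    rw [hg, enorm2_sq, hsplit, hp2, hq2, Finset.sum_div]
    have : ∑ j ∈ S, c j ^ 2 / 4 ≤ ∑ j ∈ S, ((y - x j) * c j) ^ 2 := by
      refine Finset.sum_le_sum fun j hj => ?_
      have h1 : (1 / 2) ^ 2 ≤ |y - x j| ^ 2 := by
        have := hS j hj
        gcongr
      rw [sq_abs] at h1
      rw [mul_pow]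
      nlinarith [sq_nonneg (c j)]
    linarith [sq_nonneg ((y - x i) * c i)]
  have hc'n : enorm2 c' ^ 2 ≤ p ^ 2 + q ^ 2 := by
    rw [enorm2_sq, hsplit' fun a => a ^ 2, hp2, hq2]
    have : ∑ j ∈ T, c j ^ 2 ≤ ∑ j ∈ T, ((y - x j) * c j) ^ 2 := by
      refine Finset.sum_le_sum fun j hj => ?_
      have h1 : 1 ^ 2 ≤ |y - x j| ^ 2 := by
        have := hd j hj
        gcongr
      rw [sq_abs] at h1
      rw [mul_pow]
      nlinarith [sq_nonneg (c j)]
    linarith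
  have hV0 : 0 ≤ V := enorm2_nonneg _
  have hgV : 4 * g ^ 2 * V ^ 2 ≤ p ^ 2 + q ^ 2 := by
    have h1 : 2 * g * V ≤ enorm2 c' :=
      calc 2 * g * V ≤ 2 * g * (L * enorm2 c') := by
            have := hL c'
            gcongr
        _ = (2 * L * g) * enorm2 c' := by ring
        _ ≤ 1 * enorm2 c' := by
            have := enorm2_nonneg c'
            gcongr
        _ = _ := one_mul _
    calc 4 * g ^ 2 * V ^ 2 = (2 * g * V) ^ 2 := by ring
      _ ≤ enorm2 c' ^ 2 := by gcongr
      _ ≤ _ := hc'n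
  have hCV : 1 - |u ⬝ᵥ v| ^ 2 ≤ V ^ 2 := by
    rw [hV, ← huv, enorm2_sub_smul_sq, hc, hcols, sq_abs]
    nlinarith [sq_nonneg (c i - u ⬝ᵥ v)]
  have hmain := scalar_sine_bound (abs_nonneg _) hg0 (Real.sqrt_nonneg _) (Real.sqrt_nonneg _) hV0
    hCV hVpq hpq hgV
  have hfinal : ∀ s : ℝ, s ^ 2 = 1 → s * (u ⬝ᵥ v) = |u ⬝ᵥ v| → enorm2 (u - s • v) ≤ 3 * g := by
    intro s hs hsu
    refine le_of_sq_le_sq ?_ (by positivity)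
    rw [enorm2_sub_smul_sq, hc, hcols, hs, mul_assoc, hsu]
    linarith
  rcases le_total 0 (u ⬝ᵥ v) with h | h
  · exact ⟨1, Or.inl rfl, hfinal 1 (by norm_num) (by rw [abs_of_nonneg h, one_mul])⟩
  · exact ⟨-1, Or.inr rfl, hfinal (-1) (by norm_num) (by rw [abs_of_nonpos h, neg_one_mul])⟩

/-- eigenvector perturbation bound.  Let M = U diag(D) U⁻¹ with unit
columns u_i (the eigenvectors of M, with eigenvalues D i), and M̂ = M(I + E) + F.
If κ(U)(‖ME‖₂ + ‖F‖₂) < sep(D)/2, then any unit eigenvector û of M̂ whose eigenvalue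
is paired with D i (i.e. within sep(D)/2 of it) satisfies, up to the sign of û,
‖û − u_i‖₂ ≤ 3(σ_max(E) λ_max(D) + σ_max(F)) / (σ_min(U) sep(D)). -/
theorem eigenvector_perturbation {n : ℕ} (D : Fin n → ℝ)
    (U E F M Mh : Matrix (Fin n) (Fin n) ℝ)
    (hU : IsUnit U.det)
    (hcols : ∀ i, enorm2 (fun p => U p i) = 1)
    (hM : M = U * Matrix.diagonal D * U⁻¹)
    (hMh : Mh = M * (1 + E) + F)
    (hcond : (singVal U 1 / singVal U n) * (singVal (M * E) 1 + singVal F 1) < sepD D / 2)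
    (i : Fin n) (lam : ℝ) (u : Fin n → ℝ)
    (heig : Mh.mulVec u = lam • u) (hu : enorm2 u = 1)
    (hpair : |lam - D i| < sepD D / 2) :
    ∃ s : ℝ, (s = 1 ∨ s = -1) ∧
      enorm2 (u - s • fun p => U p i) ≤
        3 * (singVal E 1 * (⨆ j, |D j|) + singVal F 1) / (singVal U n * sepD D) := by
  have hσ : 0 < singVal U n := singVal_pos_of_isUnit_det hU hu
  have hσ1 : 0 ≤ singVal U 1 := singVal_nonneg _ _
  have hsep : 0 < sepD D := by
    have : 0 ≤ (singVal U 1 / singVal U n) * (singVal (M * E) 1 + singVal F 1) :=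
      mul_nonneg (div_nonneg hσ1 hσ.le) (add_nonneg (singVal_nonneg _ _) (singVal_nonneg _ _))
    linarith
  set c := U⁻¹.mulVec u with hc
  have hUc : U.mulVec c = u := by
    rw [hc, Matrix.mulVec_mulVec, Matrix.mul_nonsing_inv U hU, Matrix.one_mulVec]
  set z : Fin n → ℝ := fun j => (lam - D j) * c j with hz
  have hUMv : ∀ w, U⁻¹.mulVec (M.mulVec w) = fun j => D j * (U⁻¹.mulVec w) j := by
    intro w
    rw [hM, Matrix.mulVec_mulVec, ← mul_assoc, ← mul_assoc, Matrix.nonsing_inv_mul U hU, one_mul,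
      ← Matrix.mulVec_mulVec]
    ext j
    rw [Matrix.mulVec_diagonal]
  have hMu : M.mulVec u + (M * E).mulVec u + F.mulVec u = lam • u := by
    rw [← heig, hMh, mul_add, mul_one, Matrix.add_mulVec, Matrix.add_mulVec]
  have hzr : z = U⁻¹.mulVec ((M * E).mulVec u + F.mulVec u) := by
    have h : (M * E).mulVec u + F.mulVec u = lam • u - M.mulVec u := by
      rw [← hMu]
      abel
    rw [h, Matrix.mulVec_sub, Matrix.mulVec_smul, hUMv]
    ext j
    simp only [hz, Pi.sub_apply, Pi.smul_apply, smul_eq_mul, hc]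
    ring
  have hinv : ∀ w, singVal U n * enorm2 (U⁻¹.mulVec w) ≤ enorm2 w := fun w => by
    simpa [Matrix.mulVec_mulVec, Matrix.mul_nonsing_inv U hU] using
      singVal_mul_enorm2_le U (U⁻¹.mulVec w)
  have hop : ∀ A : Matrix (Fin n) (Fin n) ℝ, enorm2 (A.mulVec u) ≤ singVal A 1 := fun A => by
    simpa [hu] using enorm2_mulVec_le_singVal_one A u
  have hz1 : singVal U n * enorm2 z ≤ singVal (M * E) 1 + singVal F 1 := by
    rw [hzr]
    exact ((hinv _).trans (enorm2_add_le _ _)).trans (add_le_add (hop _) (hop _))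
  have hz2 : singVal U n * enorm2 z ≤ singVal E 1 * (⨆ j, |D j|) + singVal F 1 := by
    have hD : 0 ≤ ⨆ j, |D j| := Real.iSup_nonneg fun _ => abs_nonneg _
    rw [hzr, Matrix.mulVec_add, ← Matrix.mulVec_mulVec, hUMv]
    calc _ ≤ singVal U n * ((⨆ j, |D j|) * enorm2 (U⁻¹.mulVec (E.mulVec u)) +
            enorm2 (U⁻¹.mulVec (F.mulVec u))) := by
          refine mul_le_mul_of_nonneg_left ((enorm2_add_le _ _).trans ?_) hσ.le
          exact add_le_add (enorm2_mul_le _ _) le_rfl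
      _ = (singVal U n * enorm2 (U⁻¹.mulVec (E.mulVec u))) * (⨆ j, |D j|) +
            singVal U n * enorm2 (U⁻¹.mulVec (F.mulVec u)) := by ring
      _ ≤ _ := by
          have h1 := (hinv (E.mulVec u)).trans (hop E)
          have h2 := (hinv (F.mulVec u)).trans (hop F)
          gcongr
  have hscale : ∀ a b : ℝ, |a / sepD D - b / sepD D| = |a - b| / sepD D := fun a b => by
    rw [← sub_div, abs_div, abs_of_pos hsep]
  have hg : enorm2 (fun j => (lam / sepD D - D j / sepD D) * c j) = enorm2 z / sepD D := by
    have : (fun j => (lam / sepD D - D j / sepD D) * c j) = (sepD D)⁻¹ • z := by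
      ext j
      simp only [hz, Pi.smul_apply, smul_eq_mul]
      ring
    rw [this, enorm2_smul, abs_of_pos (inv_pos.2 hsep), div_eq_inv_mul]
  obtain ⟨s, hs, hle⟩ := exists_sign_enorm2_sub_le U hcols (fun j => D j / sepD D) (lam / sepD D) i
    (fun j k hjk => by
      rw [hscale, le_div_iff₀ hsep, one_mul]
      exact sepD_le D hjk)
    (by rw [hscale, div_lt_iff₀ hsep]; linarith) c (hUc ▸ hu)
    (enorm2_mulVec_le_singVal_one U) (by
      rw [hg, ← mul_div_assoc, div_le_one hsep]
      have h1 : enorm2 z ≤ (singVal (M * E) 1 + singVal F 1) / singVal U n := by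
        rw [le_div_iff₀ hσ]
        linarith
      have h2 := mul_le_mul_of_nonneg_left h1 hσ1
      rw [mul_div_assoc', ← div_mul_eq_mul_div] at h2
      linarith)
  refine ⟨s, hs, ?_⟩
  rw [hUc, hg] at hle
  refine hle.trans ?_
  rw [← mul_div_assoc, div_le_div_iff₀ hsep (mul_pos hσ hsep)]
  linarith [mul_le_mul_of_nonneg_right hz2 hsep.le]

end
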